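/- arXiv:1706.01357 — 3 statements merged into one kernel-verified Lean document; each statement's English description precedes it below -/
import Mathlib

section
/- Let f be a density in the Fréchet class F(p_1,…,p_m) and let F : {0,1}^m → ℝ be its cumulative distribution function, F(x) = ∑_{y ≤ x} f(y) (componentwise order). Then there exists a unique family θ : {subsets of {1,…,m}} → ℝ such that for every x ∈ {0,1}^m, F(x) = (∏_{i : x_i = 0} q_i) · ∑_{S ⊆ {i : x_i = 0}} θ_S ∏_{i ∈ S} p_i; moreover this θ necessarily satisfies θ_∅ = 1 and θ_{{i}} = 0 for every i = 1,…,m. -/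
open Finset

/-- Möbius inversion on a Boolean lattice: every function on finite subsets of a finite type is the
subset-sum transform of exactly one function. -/
theorem existsUnique_sum_powerset_eq {α : Type*} [Fintype α] (G : Finset α → ℝ) :
    ∃! g : Finset α → ℝ, ∀ A, G A = ∑ S ∈ A.powerset, g S := by
  classical
  let Z : (Finset α → ℝ) →ₗ[ℝ] (Finset α → ℝ) :=
    { toFun := fun g A => ∑ S ∈ A.powerset, g S
      map_add' := fun g h => by ext A; simp [Finset.sum_add_distrib]
      map_smul' := fun c g => by ext A; simp [Finset.mul_sum] }
  have hinj : Function.Injective Z := by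
    rw [← LinearMap.ker_eq_bot, LinearMap.ker_eq_bot']
    intro g hg
    ext A
    induction A using Finset.strongInduction with
    | H A ih =>
      have hA : ∑ S ∈ A.powerset, g S = 0 := congrFun hg A
      rwa [Finset.sum_eq_single_of_mem A (Finset.mem_powerset_self A)] at hA
      intro S hS hne
      exact ih S ((Finset.mem_powerset.mp hS).ssubset_of_ne hne)
  obtain ⟨g, hg⟩ := LinearMap.injective_iff_surjective.mp hinj G
  refine ⟨g, fun A => (congrFun hg A).symm, fun h hh => hinj ?_⟩
  rw [hg]
  ext A
  exact (hh A).symm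

/-- Subsets of a finite type correspond to the zero sets of Boolean vectors. -/
theorem filter_decide_notMem_eq_false {α : Type*} [Fintype α] [DecidableEq α] (A : Finset α) :
    Finset.univ.filter (fun i => decide (i ∉ A) = false) = A := by
  ext i
  simp

/-- For any density `f` in the Fréchet class `F(p_1,…,p_m)` with cdf
`F(x) = ∑_{y ≤ x} f(y)`, there is a unique `θ : Finset (Fin m) → ℝ` with
`F(x) = (∏_{i : x_i = 0} q_i) · ∑_{S ⊆ {i : x_i = 0}} θ_S ∏_{i ∈ S} p_i` for all `x`;
moreover any such `θ` satisfies `θ_∅ = 1` and `θ_{{i}} = 0` for every `i`. -/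
theorem stmt1 (m : ℕ) (hm : 1 ≤ m) (p : Fin m → ℝ) (hp : ∀ i, 0 < p i ∧ p i < 1)
    (f : (Fin m → Bool) → ℝ)
    (hf0 : ∀ x, 0 ≤ f x) (hf1 : ∑ x, f x = 1)
    (hmarg : ∀ i, ∑ x ∈ Finset.univ.filter (fun x : Fin m → Bool => x i = true), f x = p i)
    (F : (Fin m → Bool) → ℝ)
    (hF : ∀ x, F x = ∑ y ∈ Finset.univ.filter (fun y : Fin m → Bool => ∀ i, y i ≤ x i), f y) :
    (∃! θ : Finset (Fin m) → ℝ, ∀ x,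
        F x = (∏ i ∈ Finset.univ.filter (fun i => x i = false), (1 - p i)) *
          ∑ S ∈ (Finset.univ.filter (fun i => x i = false)).powerset,
            θ S * ∏ i ∈ S, p i) ∧
    ∀ θ : Finset (Fin m) → ℝ,
      (∀ x, F x = (∏ i ∈ Finset.univ.filter (fun i => x i = false), (1 - p i)) *
          ∑ S ∈ (Finset.univ.filter (fun i => x i = false)).powerset,
            θ S * ∏ i ∈ S, p i) →
      θ ∅ = 1 ∧ ∀ i : Fin m, θ {i} = 0 := by
  constructor
  · set G : Finset (Fin m) → ℝ := fun A =>
      F (fun i => decide (i ∉ A)) / ∏ i ∈ A, (1 - p i) with hG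
    have hq : ∀ A : Finset (Fin m), ∏ i ∈ A, (1 - p i) ≠ 0 := fun A =>
      Finset.prod_ne_zero_iff.mpr fun i _ => (sub_pos.mpr (hp i).2).ne'
    have hP : ∀ A : Finset (Fin m), ∏ i ∈ A, p i ≠ 0 := fun A =>
      Finset.prod_ne_zero_iff.mpr fun i _ => (hp i).1.ne'
    have key : ∀ θ : Finset (Fin m) → ℝ, (∀ x,
        F x = (∏ i ∈ Finset.univ.filter (fun i => x i = false), (1 - p i)) *
          ∑ S ∈ (Finset.univ.filter (fun i => x i = false)).powerset,
            θ S * ∏ i ∈ S, p i) ↔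
        ∀ A, G A = ∑ S ∈ A.powerset, θ S * ∏ i ∈ S, p i := by
      intro θ
      constructor
      · intro h A
        have hA := h (fun i => decide (i ∉ A))
        rw [filter_decide_notMem_eq_false] at hA
        rw [hG]
        dsimp only
        rw [hA, mul_div_cancel_left₀ _ (hq A)]
      · intro h x
        rw [← h, hG, mul_div_cancel₀ _ (hq _)]
        congr 1
        ext i
        simp
    obtain ⟨g, hg, hgu⟩ := existsUnique_sum_powerset_eq G
    refine ⟨fun S => g S / ∏ i ∈ S, p i, (key _).mpr fun A => ?_, fun θ hθ => ?_⟩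
    · simp only [div_mul_cancel₀ _ (hP _)]
      exact hg A
    · ext S
      rw [eq_div_iff (hP S)]
      exact congrFun (hgu (fun S => θ S * ∏ i ∈ S, p i) ((key θ).mp hθ)) S
  · intro θ hθ
    have h0 : θ ∅ = 1 := by
      have h := hθ (fun _ => true)
      simpa [hF, hf1, eq_comm] using h
    refine ⟨h0, fun i => ?_⟩
    have h := hθ (fun j => decide (j ∉ ({i} : Finset (Fin m))))
    have hFi : F (fun j => decide (j ∉ ({i} : Finset (Fin m)))) = 1 - p i := by
      rw [hF, ← hf1, ← hmarg i, eq_sub_iff_add_eq, add_comm,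
        ← Finset.sum_filter_add_sum_filter_not Finset.univ
          (fun x : Fin m → Bool => x i = true) f]
      congr 2
      ext y
      simp only [Finset.mem_filter, Finset.mem_univ, true_and, Finset.mem_singleton]
      constructor
      · intro hy
        have h' := hy i
        simp only [not_true_eq_false, decide_false] at h'
        simpa using le_bot_iff.mp h'
      · intro hy j
        by_cases hj : j = i
        · subst hj
          simp_all
        · simp [hj, Bool.le_true]
    have hpow : ({i} : Finset (Fin m)).powerset = {∅, {i}} := by
      ext S
      simp [Finset.subset_singleton_iff]
    rw [filter_decide_notMem_eq_false, hFi, Finset.prod_singleton, hpow,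
      Finset.sum_pair (Finset.singleton_ne_empty i).symm, h0, Finset.prod_empty,
      Finset.prod_singleton] at h
    have hz : (1 - p i) * p i * θ {i} = 0 := by linarith
    exact (mul_eq_zero.mp hz).resolve_left
      (mul_pos (sub_pos.mpr (hp i).2) (hp i).1).ne'
end

section
/- Let 0 < p_1, p_2 < 1 with q_i = 1 − p_i and assume q_2 ≥ q_1. For a density f in the Fréchet class F(p_1,p_2), let θ = (f(0,0) − q_1 q_2)/(q_1 q_2 p_1 p_2). Then: (1) if q_1 + q_2 ≤ 1, −1/(p_1 p_2) ≤ θ ≤ 1/(p_1 q_2); (2) if q_1 + q_2 > 1, (q_1 + q_2 − 1 − q_1 q_2)/(q_1 q_2 p_1 p_2) ≤ θ ≤ 1/(p_1 q_2). -/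
/-- Membership in the bivariate Fréchet class `F(p1,p2)`. -/
def memFrechet2 (p1 p2 : ℝ) (f : Bool → Bool → ℝ) : Prop :=
  (∀ b1 b2, 0 ≤ f b1 b2) ∧
  f false false + f false true + f true false + f true true = 1 ∧
  f true false + f true true = p1 ∧
  f false true + f true true = p2

/-- Assume `q2 ≥ q1`. For a density `f` of the bivariate Fréchet class
`F(p1,p2)`, with FGM parameter `θ = (f(0,0) − q1 q2)/(q1 q2 p1 p2)`:
(1) if `q1 + q2 ≤ 1` then `−1/(p1 p2) ≤ θ ≤ 1/(p1 q2)`;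
(2) if `q1 + q2 > 1` then `(q1 + q2 − 1 − q1 q2)/(q1 q2 p1 p2) ≤ θ ≤ 1/(p1 q2)`. -/
theorem stmt15 (p1 p2 q1 q2 : ℝ) (hp1 : 0 < p1 ∧ p1 < 1) (hp2 : 0 < p2 ∧ p2 < 1)
    (hq1 : q1 = 1 - p1) (hq2 : q2 = 1 - p2) (hq : q1 ≤ q2)
    (f : Bool → Bool → ℝ) (hf : memFrechet2 p1 p2 f)
    (θ : ℝ) (hθ : θ = (f false false - q1 * q2) / (q1 * q2 * p1 * p2)) :
    (q1 + q2 ≤ 1 → -(1 / (p1 * p2)) ≤ θ ∧ θ ≤ 1 / (p1 * q2)) ∧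
    (q1 + q2 > 1 → (q1 + q2 - 1 - q1 * q2) / (q1 * q2 * p1 * p2) ≤ θ ∧ θ ≤ 1 / (p1 * q2)) := by
  obtain ⟨hnonneg, hsum, hx, hy⟩ := hf
  have hp1_pos : 0 < p1 := hp1.1
  have hp2_pos : 0 < p2 := hp2.1
  have hq1_pos : 0 < q1 := by linarith [hp1.2]
  have hq2_pos : 0 < q2 := by linarith [hp2.2]
  have hD : 0 < q1 * q2 * p1 * p2 := by positivity
  have h00_le : f false false ≤ q1 := by linarith [hnonneg false true]
  have h_upper : θ ≤ 1 / (p1 * q2) := by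
    have h_eq : 1 / (p1 * q2) = (q1 - q1 * q2) / (q1 * q2 * p1 * p2) := by
      have hp2_eq : q1 - q1 * q2 = q1 * p2 := by rw [hq2]; ring
      rw [hp2_eq]
      field_simp
    rw [hθ, h_eq]
    gcongr
  refine ⟨fun _ => ⟨?_, h_upper⟩, fun _ => ⟨?_, h_upper⟩⟩
  · have h_eq : -(1 / (p1 * p2)) = (0 - q1 * q2) / (q1 * q2 * p1 * p2) := by
      field_simp
      ring
    rw [hθ, h_eq]
    gcongr
    exact hnonneg false false
  · rw [hθ]
    gcongr
    linarith [hnonneg true true]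
end

section
/- Let 0 < p_1, p_2 < 1 with q_i = 1 − p_i and assume q_2 ≥ q_1. For a density f in the Fréchet class F(p_1,p_2), let ρ_{12} = (f(1,1) − p_1 p_2)/√(p_1 q_1 p_2 q_2) be the correlation of the corresponding pair of Bernoulli variables. Then: (1) if q_1 + q_2 ≤ 1, −√(q_1 q_2/(p_1 p_2)) ≤ ρ_{12} ≤ √(p_2 q_1/(p_1 q_2)); (2) if q_1 + q_2 > 1, −√(p_1 p_2/(q_1 q_2)) ≤ ρ_{12} ≤ √(p_2 q_1/(p_1 q_2)). -/
theorem Real.sqrt_div_eq_div_sqrt_mul {a : ℝ} (ha : 0 ≤ a) (b : ℝ) :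
    √(a / b) = a / √(a * b) := by
  rw [Real.sqrt_div ha, Real.sqrt_mul ha, ← div_div, Real.div_sqrt]

/-- Assume `q2 ≥ q1`. For a density `f` of the bivariate Fréchet class
`F(p1,p2)`, with correlation `ρ12 = (f(1,1) − p1 p2)/√(p1 q1 p2 q2)`:
(1) if `q1 + q2 ≤ 1` then `−√(q1 q2/(p1 p2)) ≤ ρ12 ≤ √(p2 q1/(p1 q2))`;
(2) if `q1 + q2 > 1` then `−√(p1 p2/(q1 q2)) ≤ ρ12 ≤ √(p2 q1/(p1 q2))`. -/
theorem stmt16 (p1 p2 q1 q2 : ℝ) (hp1 : 0 < p1 ∧ p1 < 1) (hp2 : 0 < p2 ∧ p2 < 1)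
    (hq1 : q1 = 1 - p1) (hq2 : q2 = 1 - p2) (hq : q1 ≤ q2)
    (f : Bool → Bool → ℝ) (hf : memFrechet2 p1 p2 f)
    (ρ : ℝ) (hρ : ρ = (f true true - p1 * p2) / Real.sqrt (p1 * q1 * p2 * q2)) :
    (q1 + q2 ≤ 1 →
      -Real.sqrt (q1 * q2 / (p1 * p2)) ≤ ρ ∧ ρ ≤ Real.sqrt (p2 * q1 / (p1 * q2))) ∧
    (q1 + q2 > 1 →
      -Real.sqrt (p1 * p2 / (q1 * q2)) ≤ ρ ∧ ρ ≤ Real.sqrt (p2 * q1 / (p1 * q2))) := by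
  obtain ⟨hnn, hsum, hm1, hm2⟩ := hf
  have h00 := hnn false false
  have h01 := hnn false true
  have h11 := hnn true true
  have hq1pos : 0 < q1 := by linarith
  have hq2pos : 0 < q2 := by linarith
  have hp1pos := hp1.1
  have hp2pos := hp2.1
  have hupper : ρ ≤ √(p2 * q1 / (p1 * q2)) := by
    rw [hρ, Real.sqrt_div_eq_div_sqrt_mul (by positivity),
      show p2 * q1 * (p1 * q2) = p1 * q1 * p2 * q2 by ring]
    gcongr
    subst hq1
    nlinarith
  refine ⟨fun _ => ⟨?_, hupper⟩, fun _ => ⟨?_, hupper⟩⟩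
  · rw [hρ, Real.sqrt_div_eq_div_sqrt_mul (by positivity),
      show q1 * q2 * (p1 * p2) = p1 * q1 * p2 * q2 by ring, ← neg_div]
    gcongr
    subst hq1 hq2
    nlinarith
  · rw [hρ, Real.sqrt_div_eq_div_sqrt_mul (by positivity),
      show p1 * p2 * (q1 * q2) = p1 * q1 * p2 * q2 by ring, ← neg_div]
    gcongr
    linarith
end
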